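/- Let U ⊆ ℂ³ be open, let g : U → Mat₃(ℂ) be C^∞ (in the real sense) with g(z) Hermitian positive definite for every z ∈ U, Kähler, and Ricci-flat. Let H : U → Mat_n(ℂ) be C^∞ with H(z) Hermitian positive definite for every z, satisfying the Hermitian–Yang–Mills equation Σ_{i,j} g^{ij̄} · ∂/∂z̄_j ((∂H/∂z_i) · H⁻¹) = 0 on U. Define A_i := (∂H/∂z_i) · H⁻¹ and the real-valued function φ := Σ_{i,j} g^{ij̄} · tr(A_i · H · A_j* · H⁻¹) on U (where A_j* is the conjugate transpose of A_j). Then at every point of U, Σ_{i,j} g^{ij̄} · ∂²φ/∂z_i∂z̄_j is a nonnegative real number; equivalently, −Δ_g |∂H·H⁻¹|²_{H,g} ≤ 0, i.e. the squared norm of the Chern connection form of a Hermitian–Yang–Mills metric on a trivial bundle over a Ricci-flat Kähler domain is subharmonic. -/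

import Mathlib

open scoped ComplexOrder

/-- The Wirtinger derivative `∂f/∂zᵢ` of a real-differentiable function `f : ℂ³ → ℂ`. -/
noncomputable def wd (i : Fin 3) (f : (Fin 3 → ℂ) → ℂ) (z : Fin 3 → ℂ) : ℂ :=
  (1 / 2 : ℂ) *
    (fderiv ℝ f z (Pi.single i 1) - Complex.I * fderiv ℝ f z (Pi.single i Complex.I))

/-- The conjugate Wirtinger derivative `∂f/∂z̄ᵢ` of a real-differentiable function
`f : ℂ³ → ℂ`. -/
noncomputable def wdb (i : Fin 3) (f : (Fin 3 → ℂ) → ℂ) (z : Fin 3 → ℂ) : ℂ :=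
  (1 / 2 : ℂ) *
    (fderiv ℝ f z (Pi.single i 1) + Complex.I * fderiv ℝ f z (Pi.single i Complex.I))

/-- The component `A_i = (∂H/∂z_i)·H⁻¹` of the Chern connection form of a Hermitian
metric `H` on a trivial bundle over a domain in `ℂ³`. -/
noncomputable def chernForm {n : ℕ} (H : (Fin 3 → ℂ) → Matrix (Fin n) (Fin n) ℂ)
    (i : Fin 3) (z : Fin 3 → ℂ) : Matrix (Fin n) (Fin n) ℂ :=
  Matrix.of fun a b => ∑ c, wd i (fun w => H w a c) z * (H z)⁻¹ c b

section Helpers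
open Matrix

section MatDeriv
set_option linter.unusedSectionVars false
variable {R : Type*} [CommRing R] {m n p : Type*} [Fintype m] [Fintype n] [Fintype p]

/-- entrywise derivation of a matrix -/
def dM (D : Derivation ℤ R R) (M : Matrix m n R) : Matrix m n R := M.map D

lemma dM_apply (D : Derivation ℤ R R) (M : Matrix m n R) (i : m) (j : n) :
    dM D M i j = D (M i j) := rfl

lemma dM_mul (D : Derivation ℤ R R) (M : Matrix m n R) (N : Matrix n p R) :
    dM D (M * N) = dM D M * N + M * dM D N := by
  ext i j
  simp only [dM_apply, Matrix.mul_apply, Matrix.add_apply, map_sum, Derivation.leibniz,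
    smul_eq_mul, Finset.sum_add_distrib]
  rw [add_comm]
  congr 1
  exact Finset.sum_congr rfl fun _ _ => mul_comm _ _

lemma dM_add (D : Derivation ℤ R R) (M N : Matrix m n R) :
    dM D (M + N) = dM D M + dM D N := by
  ext i j; simp [dM_apply]

lemma dM_sub (D : Derivation ℤ R R) (M N : Matrix m n R) :
    dM D (M - N) = dM D M - dM D N := by
  ext i j; simp [dM_apply]

lemma dM_neg (D : Derivation ℤ R R) (M : Matrix m n R) :
    dM D (-M) = - dM D M := by
  ext i j; simp [dM_apply]

lemma dM_zero (D : Derivation ℤ R R) :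
    dM D (0 : Matrix m n R) = 0 := by
  ext i j; simp [dM_apply]

lemma dM_smul (D : Derivation ℤ R R) (r : R) (M : Matrix m n R) :
    dM D (r • M) = D r • M + r • dM D M := by
  ext i j; simp [dM_apply]; ring

lemma dM_sum {ι : Type*} (D : Derivation ℤ R R) (s : Finset ι) (f : ι → Matrix m n R) :
    dM D (∑ i ∈ s, f i) = ∑ i ∈ s, dM D (f i) := by
  ext i j; simp [dM_apply, Matrix.sum_apply]

lemma dM_one [DecidableEq m] (D : Derivation ℤ R R) : dM D (1 : Matrix m m R) = 0 := by
  ext i j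
  by_cases h : i = j
  · subst h; simp [dM_apply]
  · simp [dM_apply, Matrix.one_apply_ne h]

lemma dM_trace (D : Derivation ℤ R R) (M : Matrix m m R) : D (trace M) = trace (dM D M) := by
  simp [Matrix.trace, dM_apply]

lemma dM_inv [DecidableEq m] (D : Derivation ℤ R R) (M N : Matrix m m R) (h : M * N = 1)
    (h' : N * M = 1) : dM D N = - (N * (dM D M * N)) := by
  have h1 := dM_mul D M N
  rw [h, dM_one] at h1
  have h2 : M * dM D N = - (dM D M * N) := by
    rw [eq_neg_iff_add_eq_zero, add_comm]; exact h1.symm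
  calc dM D N = (N * M) * dM D N := by rw [h', one_mul]
    _ = N * (M * dM D N) := by rw [mul_assoc]
    _ = _ := by rw [h2, mul_neg]

end MatDeriv

/-- The algebraic data of a HYM metric over a Ricci-flat Kähler domain, over a differential ring. -/
structure HymSetup (R : Type*) [CommRing R] [StarRing R] (n : ℕ) where
  d : Fin 3 → Derivation ℤ R R
  e : Fin 3 → Derivation ℤ R R
  dd : ∀ i j f, d i (d j f) = d j (d i f)
  de : ∀ i j f, d i (e j f) = e j (d i f)
  star_d : ∀ i f, star (d i f) = e i (star f)
  g : Matrix (Fin 3) (Fin 3) R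
  P : Matrix (Fin 3) (Fin 3) R
  g_star : gᴴ = g
  gP : g * P = 1
  Pg : P * g = 1
  kah : ∀ i j k, d k (g i j) = d i (g k j)
  L : Fin 3 → R
  hL : ∀ j, g.det * L j = e j g.det
  dL : ∀ i j, d i (L j) = 0
  H : Matrix (Fin n) (Fin n) R
  Q : Matrix (Fin n) (Fin n) R
  H_star : Hᴴ = H
  HQ : H * Q = 1
  QH : Q * H = 1
  hym : ∑ i, ∑ j, P j i • dM (e j) (dM (d i) H * Q) = 0

namespace HymSetup
set_option linter.unusedSectionVars false
variable {R : Type*} [CommRing R] [StarRing R] {n : ℕ} (S : HymSetup R n)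

/-- connection form -/
def A (i : Fin 3) : Matrix (Fin n) (Fin n) R := dM (S.d i) S.H * S.Q

/-- Christoffel symbols -/
def Γ (k : Fin 3) : Matrix (Fin 3) (Fin 3) R := dM (S.d k) S.g * S.P

/-- covariant derivative -/
def nab (k : Fin 3) (a : Fin 3 → Matrix (Fin n) (Fin n) R) (i : Fin 3) :
    Matrix (Fin n) (Fin n) R :=
  dM (S.d k) (a i) - ∑ m, S.Γ k i m • a m + a i * S.A k - S.A k * a i

/-- antiholomorphic derivative -/
def nabb (k : Fin 3) (a : Fin 3 → Matrix (Fin n) (Fin n) R) (i : Fin 3) :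
    Matrix (Fin n) (Fin n) R := dM (S.e k) (a i)

/-- pairing -/
def pair (a b : Fin 3 → Matrix (Fin n) (Fin n) R) : R :=
  ∑ i, ∑ j, S.P j i * trace (a i * S.H * (b j)ᴴ * S.Q)

lemma star_e (i f) : star (S.e i f) = S.d i (star f) := by
  have := S.star_d i (star f)
  rw [star_star] at this
  rw [← this, star_star]

lemma P_star : S.Pᴴ = S.P := by
  have h : S.Pᴴ * S.g = 1 := by
    have := congrArg conjTranspose S.gP
    rwa [conjTranspose_mul, S.g_star, conjTranspose_one] at this
  calc S.Pᴴ = S.Pᴴ * (S.g * S.P) := by rw [S.gP, mul_one]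
    _ = S.P := by rw [← mul_assoc, h, one_mul]

lemma Q_star : S.Qᴴ = S.Q := by
  have h : S.Qᴴ * S.H = 1 := by
    have := congrArg conjTranspose S.HQ
    rwa [conjTranspose_mul, S.H_star, conjTranspose_one] at this
  calc S.Qᴴ = S.Qᴴ * (S.H * S.Q) := by rw [S.HQ, mul_one]
    _ = S.Q := by rw [← mul_assoc, h, one_mul]

lemma kah' (i j k) : S.e k (S.g i j) = S.e j (S.g i k) := by
  have hs : ∀ a b, star (S.g a b) = S.g b a := fun a b => by
    conv_rhs => rw [← S.g_star]
    rw [conjTranspose_apply]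
  have := congrArg star (S.kah j i k)
  rwa [S.star_d, S.star_d, hs, hs] at this

lemma dH (k) : dM (S.d k) S.H = S.A k * S.H := by
  rw [A, mul_assoc, S.QH, mul_one]

lemma dQ (k) : dM (S.d k) S.Q = - (S.Q * S.A k) := dM_inv _ _ _ S.HQ S.QH

lemma dP (k) : dM (S.d k) S.P = - (S.P * S.Γ k) := dM_inv _ _ _ S.gP S.Pg

lemma dP' (k i j) : S.d k (S.P j i) = - ∑ m, S.P j m * S.Γ k m i := by
  have := congrFun (congrFun (S.dP k) j) i
  rw [dM_apply] at this
  rw [this, Matrix.neg_apply, Matrix.mul_apply]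

lemma Γ_symm (k i m) : S.Γ k i m = S.Γ i k m := by
  simp only [Γ, Matrix.mul_apply, dM_apply]
  exact Finset.sum_congr rfl fun q _ => by rw [S.kah]

lemma dM_conjTranspose_d (k) (b : Matrix (Fin n) (Fin n) R) :
    dM (S.d k) bᴴ = (dM (S.e k) b)ᴴ := by
  ext i j
  simp [dM_apply, conjTranspose_apply, S.star_e]

lemma d_tr (k) (a b : Matrix (Fin n) (Fin n) R) :
    S.d k (trace (a * S.H * bᴴ * S.Q)) =
      trace ((dM (S.d k) a + a * S.A k - S.A k * a) * S.H * bᴴ * S.Q)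
        + trace (a * S.H * (dM (S.e k) b)ᴴ * S.Q) := by
  rw [dM_trace, dM_mul, dM_mul, dM_mul, S.dQ, S.dH, S.dM_conjTranspose_d]
  have : trace (S.A k * a * S.H * bᴴ * S.Q) = trace (a * S.H * bᴴ * (S.Q * S.A k)) := by
    have h := trace_mul_comm (S.A k) (a * S.H * bᴴ * S.Q)
    simpa only [mul_assoc] using h
  simp only [add_mul, sub_mul, trace_add, trace_sub, mul_neg, trace_neg, this]
  simp only [mul_assoc]
  ring

lemma d_pair (k) (a b) :
    S.d k (S.pair a b) = S.pair (S.nab k a) b + S.pair a (S.nabb k b) := by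
  have h1 : ∀ i j, trace (S.nab k a i * S.H * (b j)ᴴ * S.Q) =
      trace ((dM (S.d k) (a i) + a i * S.A k - S.A k * a i) * S.H * (b j)ᴴ * S.Q)
      - ∑ m, S.Γ k i m * trace (a m * S.H * (b j)ᴴ * S.Q) := by
    intro i j
    simp only [nab, add_mul, sub_mul, trace_add, trace_sub, Finset.sum_mul, trace_sum,
      smul_mul_assoc, trace_smul, smul_eq_mul]
    ring
  simp only [pair, h1, map_sum, Derivation.leibniz, smul_eq_mul, S.d_tr, S.dP', nabb]
  simp only [Fin.sum_univ_three]
  ring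

lemma star_pair (a b) : star (S.pair a b) = S.pair b a := by
  have hP : ∀ i j, star (S.P i j) = S.P j i := fun i j => by
    conv_rhs => rw [← S.P_star]
    rw [conjTranspose_apply]
  simp only [pair, star_sum, star_mul', hP]
  rw [Finset.sum_comm]
  refine Finset.sum_congr rfl fun i _ => Finset.sum_congr rfl fun j _ => ?_
  congr 1
  rw [← trace_conjTranspose]
  simp only [conjTranspose_mul, conjTranspose_conjTranspose, S.H_star, S.Q_star]
  rw [trace_mul_comm]
  simp only [mul_assoc]

lemma e_pair (k) (a b) :
    S.e k (S.pair a b) = S.pair (S.nabb k a) b + S.pair a (S.nab k b) := by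
  rw [← S.star_pair b a, ← S.star_d, S.d_pair, star_add, S.star_pair, S.star_pair, add_comm]

lemma dd_pair (k l) (a) :
    S.d k (S.e l (S.pair a a)) = S.pair (S.nab k (S.nabb l a)) a
      + S.pair (S.nabb l a) (S.nabb k a) + S.pair (S.nab k a) (S.nab l a)
      + S.pair a (S.nabb k (S.nab l a)) := by
  rw [S.e_pair, map_add, S.d_pair, S.d_pair]; ring

lemma dM_de (k l) {m p : Type*} [Fintype m] [Fintype p] (M : Matrix m p R) :
    dM (S.d k) (dM (S.e l) M) = dM (S.e l) (dM (S.d k) M) := by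
  ext i j; simp [dM_apply, S.de]

lemma dM_dd (k l) {m p : Type*} [Fintype m] [Fintype p] (M : Matrix m p R) :
    dM (S.d k) (dM (S.d l) M) = dM (S.d l) (dM (S.d k) M) := by
  ext i j; simp only [dM_apply]; rw [S.dd]

lemma dA (i k) : dM (S.d i) (S.A k) = dM (S.d i) (dM (S.d k) S.H) * S.Q - S.A k * S.A i := by
  rw [A, dM_mul, S.dQ, ← A, mul_neg, ← mul_assoc, ← A]; abel

lemma dA_sub (i k) : dM (S.d k) (S.A i) =
    dM (S.d i) (S.A k) - S.A i * S.A k + S.A k * S.A i := by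
  rw [S.dA, S.dA, S.dM_dd i k]; abel

lemma hym' : ∑ i, ∑ j, S.P j i • dM (S.e j) (S.A i) = 0 := S.hym

lemma bianchi (i k l) : S.nab k (S.nabb l S.A) i =
    dM (S.d i) (dM (S.e l) (S.A k)) - ∑ m, S.Γ k i m • dM (S.e l) (S.A m)
      + dM (S.e l) (S.A k) * S.A i - S.A i * dM (S.e l) (S.A k) := by
  simp only [nab, nabb]
  rw [S.dM_de, S.dA_sub, dM_add, dM_sub, dM_mul, dM_mul, S.dM_de]
  abel

lemma fact1 (i) : ∑ k, ∑ l, S.P l k • S.nab k (S.nabb l S.A) i = 0 := by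
  have h0 := congrArg (dM (S.d i)) S.hym'
  simp only [dM_sum, dM_smul, dM_zero, S.dP'] at h0
  have h1 := congrArg (fun M => M * S.A i) S.hym'
  have h2 := congrArg (fun M => S.A i * M) S.hym'
  simp only [Finset.sum_mul, Finset.mul_sum, zero_mul, mul_zero, smul_mul_assoc,
    mul_smul_comm] at h1 h2
  simp only [S.bianchi]
  have : ∀ k m, S.Γ k i m = S.Γ i k m := fun k m => S.Γ_symm k i m
  simp only [this]
  have key : ∀ (X : Fin 3 → Fin 3 → Matrix (Fin n) (Fin n) R),
      ∑ k, ∑ l, S.P l k • (X k l - ∑ m, S.Γ i k m • dM (S.e l) (S.A m)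
        + dM (S.e l) (S.A k) * S.A i - S.A i * dM (S.e l) (S.A k))
      = ∑ k, ∑ l, ((-∑ m, S.P l m * S.Γ i m k) • dM (S.e l) (S.A k) + S.P l k • X k l)
      + ∑ k, ∑ l, S.P l k • (dM (S.e l) (S.A k) * S.A i)
      - ∑ k, ∑ l, S.P l k • (S.A i * dM (S.e l) (S.A k)) := by
    intro X
    simp only [Fin.sum_univ_three]
    module
  rw [key, h0, h1, h2]; simp

lemma det_deriv (D : Derivation ℤ R R) (M : Matrix (Fin 3) (Fin 3) R) :
    D M.det = trace (M.adjugate * dM D M) := by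
  rw [det_fin_three, Matrix.adjugate_fin_three]
  simp only [Matrix.trace, Matrix.diag, Matrix.mul_apply, Fin.sum_univ_three, dM_apply]
  simp [Derivation.leibniz]
  ring

lemma L_eq (j) : S.L j = trace (S.P * dM (S.e j) S.g) := by
  have hadj : S.g.adjugate = S.g.det • S.P := by
    calc S.g.adjugate = S.g.adjugate * (S.g * S.P) := by rw [S.gP, mul_one]
      _ = _ := by rw [← mul_assoc, adjugate_mul, smul_mul_assoc, one_mul]
  have hu : S.P.det * S.g.det = 1 := by rw [← det_mul, S.Pg, det_one]
  have h := S.hL j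
  rw [det_deriv, hadj, smul_mul_assoc, trace_smul, smul_eq_mul] at h
  have := congrArg (fun x => S.P.det * x) h
  simpa only [← mul_assoc, hu, one_mul] using this

lemma ricci (i m) : ∑ l, ∑ k, S.P k l * S.e k (S.Γ l i m) = 0 := by
  have hs : ∀ l, S.Γ l i m = S.Γ i l m := fun l => S.Γ_symm l i m
  simp only [hs]
  have key : ∀ k, S.P * dM (S.e k) (S.Γ i) = dM (S.d i) (S.P * dM (S.e k) S.g) * S.P := by
    intro k
    have hP : dM (S.e k) S.P = - (S.P * (dM (S.e k) S.g * S.P)) := dM_inv _ _ _ S.gP S.Pg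
    rw [dM_mul, S.dP, Γ, dM_mul, hP, S.dM_de]
    simp only [mul_add, add_mul, mul_neg, neg_mul, mul_assoc]
    abel
  have h1 : ∀ q, ∑ k, (S.P * dM (S.e k) S.g) k q = S.L q := by
    intro q
    rw [S.L_eq]
    simp only [trace, Matrix.diag, Matrix.mul_apply, dM_apply]
    refine Finset.sum_congr rfl fun k _ => Finset.sum_congr rfl fun s _ => ?_
    rw [S.kah']
  calc ∑ l, ∑ k, S.P k l * S.e k (S.Γ i l m)
      = ∑ k, (S.P * dM (S.e k) (S.Γ i)) k m := by
        rw [Finset.sum_comm]; simp only [Matrix.mul_apply, dM_apply]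
    _ = ∑ q, S.d i (∑ k, (S.P * dM (S.e k) S.g) k q) * S.P q m := by
        simp only [key, map_sum, Finset.sum_mul]
        rw [Finset.sum_comm]
        exact Finset.sum_congr rfl fun k _ => Matrix.mul_apply
    _ = 0 := by simp [h1, S.dL]

lemma comm_nab (k l) (a) (i) : S.nabb k (S.nab l a) i = S.nab l (S.nabb k a) i
    - ∑ m, S.e k (S.Γ l i m) • a m + a i * dM (S.e k) (S.A l) - dM (S.e k) (S.A l) * a i := by
  simp only [nab, nabb, dM_sub, dM_add, dM_mul, dM_sum, dM_smul, S.dM_de, Finset.sum_add_distrib]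
  abel

lemma fact2 (i) : ∑ l, ∑ k, S.P k l • S.nabb k (S.nab l S.A) i = 0 := by
  have h0 := S.fact1 i
  have h1 := congrArg (fun M => M * S.A i) S.hym'
  have h2 := congrArg (fun M => S.A i * M) S.hym'
  simp only [Finset.sum_mul, Finset.mul_sum, zero_mul, mul_zero, smul_mul_assoc,
    mul_smul_comm] at h1 h2
  have h3 : ∑ m, (∑ l, ∑ k, S.P k l * S.e k (S.Γ l i m)) • S.A m = 0 := by simp [S.ricci]
  simp only [S.comm_nab]
  have : ∑ l, ∑ k, S.P k l • (S.nab l (S.nabb k S.A) i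
    - ∑ m, S.e k (S.Γ l i m) • S.A m + S.A i * dM (S.e k) (S.A l) - dM (S.e k) (S.A l) * S.A i)
    = ∑ l, ∑ k, S.P k l • S.nab l (S.nabb k S.A) i
      - ∑ m, (∑ l, ∑ k, S.P k l * S.e k (S.Γ l i m)) • S.A m
      + ∑ l, ∑ k, S.P k l • (S.A i * dM (S.e k) (S.A l))
      - ∑ l, ∑ k, S.P k l • (dM (S.e k) (S.A l) * S.A i) := by
    simp only [Fin.sum_univ_three]
    module
  rw [this, h0, h1, h2, h3]; simp

lemma pair_sum_left (c : Fin 3 → Fin 3 → R)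
    (a : Fin 3 → Fin 3 → Fin 3 → Matrix (Fin n) (Fin n) R) (b) :
    ∑ k, ∑ l, c k l * S.pair (a k l) b = S.pair (fun i => ∑ k, ∑ l, c k l • a k l i) b := by
  simp only [pair, Finset.sum_mul, trace_sum, smul_mul_assoc, trace_smul, smul_eq_mul]
  simp only [Fin.sum_univ_three]
  ring

theorem main :
    ∑ k, ∑ l, S.P l k * S.d k (S.e l (S.pair S.A S.A)) =
      ∑ k, ∑ l, S.P l k * S.pair (S.nab k S.A) (S.nab l S.A) +
      ∑ k, ∑ l, S.P l k * S.pair (S.nabb l S.A) (S.nabb k S.A) := by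
  have hP : ∀ i j, star (S.P i j) = S.P j i := fun i j => by
    conv_rhs => rw [← S.P_star]
    rw [conjTranspose_apply]
  have z : ∀ b, S.pair (fun _ => 0) b = 0 := fun b => by simp [pair]
  have e1 : ∑ k, ∑ l, S.P l k * S.pair (S.nab k (S.nabb l S.A)) S.A = 0 := by
    rw [S.pair_sum_left (fun k l => S.P l k) (fun k l => S.nab k (S.nabb l S.A))]
    simp only [S.fact1, z]
  have e2 : ∑ k, ∑ l, S.P l k * S.pair S.A (S.nabb k (S.nab l S.A)) = 0 := by
    have : ∑ l, ∑ k, S.P k l * S.pair (S.nabb k (S.nab l S.A)) S.A = 0 := by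
      rw [S.pair_sum_left (fun l k => S.P k l) (fun l k => S.nabb k (S.nab l S.A))]
      simp only [S.fact2, z]
    have := congrArg star this
    simp only [star_sum, star_mul', hP, S.star_pair, star_zero] at this
    rw [Finset.sum_comm]
    exact this
  simp only [S.dd_pair, mul_add, Finset.sum_add_distrib, e1, e2]
  ring

end HymSetup

section Pos
variable {n : ℕ}

lemma tr_nonneg (H X : Matrix (Fin n) (Fin n) ℂ) (hH : H.PosDef) :
    0 ≤ trace (X * H * Xᴴ * H⁻¹) := by
  obtain ⟨m, v, hv⟩ := Matrix.posSemidef_iff_eq_sum_vecMulVec.mp hH.inv.posSemidef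
  have h1 : (X * H * Xᴴ).PosSemidef := hH.posSemidef.mul_mul_conjTranspose_same X
  rw [hv, Finset.mul_sum, trace_sum]
  refine Finset.sum_nonneg fun i _ => ?_
  rw [mul_vecMulVec, trace_vecMulVec, dotProduct_comm]
  exact h1.dotProduct_mulVec_nonneg (v i)

lemma pair_nonneg (H : Matrix (Fin n) (Fin n) ℂ) (hH : H.PosDef)
    (G : Matrix (Fin 3) (Fin 3) ℂ) (hG : G.PosSemidef)
    (X : Fin 3 → Matrix (Fin n) (Fin n) ℂ) :
    0 ≤ ∑ i, ∑ j, G i j * trace (X i * H * (X j)ᴴ * H⁻¹) := by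
  obtain ⟨m, v, hv⟩ := Matrix.posSemidef_iff_eq_sum_vecMulVec.mp hG
  have : ∑ i, ∑ j, G i j * trace (X i * H * (X j)ᴴ * H⁻¹) =
      ∑ p, trace ((∑ i, v p i • X i) * H * (∑ i, v p i • X i)ᴴ * H⁻¹) := by
    simp only [hv, Matrix.sum_apply, vecMulVec_apply, conjTranspose_sum, conjTranspose_smul,
      Finset.sum_mul, Finset.mul_sum, trace_sum, smul_mul_assoc, mul_smul_comm, trace_smul,
      smul_eq_mul, Pi.star_apply]
    simp only [Fin.sum_univ_three, ← Finset.sum_add_distrib]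
    refine Finset.sum_congr rfl fun p _ => ?_
    ring
  rw [this]
  exact Finset.sum_nonneg fun p _ => tr_nonneg H _ hH

lemma pair2_nonneg (H : Matrix (Fin n) (Fin n) ℂ) (hH : H.PosDef)
    (G K : Matrix (Fin 3) (Fin 3) ℂ) (hG : G.PosSemidef) (hK : K.PosSemidef)
    (X : Fin 3 → Fin 3 → Matrix (Fin n) (Fin n) ℂ) :
    0 ≤ ∑ k, ∑ l, K k l * ∑ i, ∑ j, G i j * trace (X k i * H * (X l j)ᴴ * H⁻¹) := by
  obtain ⟨m, v, hv⟩ := Matrix.posSemidef_iff_eq_sum_vecMulVec.mp hK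
  have : ∑ k, ∑ l, K k l * ∑ i, ∑ j, G i j * trace (X k i * H * (X l j)ᴴ * H⁻¹) =
      ∑ p, ∑ i, ∑ j, G i j *
        trace ((∑ k, v p k • X k i) * H * (∑ k, v p k • X k j)ᴴ * H⁻¹) := by
    have h : ∀ p i j, trace ((∑ k, v p k • X k i) * H * (∑ k, v p k • X k j)ᴴ * H⁻¹) =
        ∑ k, ∑ l, v p k * star (v p l) * trace (X k i * H * (X l j)ᴴ * H⁻¹) := by
      intro p i j
      simp only [conjTranspose_sum, conjTranspose_smul,
        Finset.sum_mul, Finset.mul_sum, trace_sum, smul_mul_assoc, mul_smul_comm, trace_smul,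
        smul_eq_mul]
      simp only [Fin.sum_univ_three]
      ring
    simp only [h]
    generalize hT : (fun k l i j => trace (X k i * H * (X l j)ᴴ * H⁻¹)) = T
    have hT' : ∀ k l i j, trace (X k i * H * (X l j)ᴴ * H⁻¹) = T k l i j := fun k l i j => by
      rw [← hT]
    simp only [hT', hv, Matrix.sum_apply, vecMulVec_apply, Pi.star_apply, Finset.sum_mul]
    rw [Finset.sum_congr rfl fun k _ => Finset.sum_comm, Finset.sum_comm]
    refine Finset.sum_congr rfl fun p _ => ?_
    simp only [Finset.mul_sum]
    rw [Finset.sum_congr rfl fun k _ => Finset.sum_comm, Finset.sum_comm]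
    refine Finset.sum_congr rfl fun i _ => ?_
    rw [Finset.sum_congr rfl fun k _ => Finset.sum_comm, Finset.sum_comm]
    refine Finset.sum_congr rfl fun j _ => ?_
    refine Finset.sum_congr rfl fun k _ => ?_
    refine Finset.sum_congr rfl fun l _ => ?_
    ring
  rw [this]
  exact Finset.sum_nonneg fun p _ => pair_nonneg H hH G hG _

end Pos

section Analysis

/-- `wd` and `wdb` in one: coefficient `s = ∓ I`. -/
noncomputable def wirt (s : ℂ) (i : Fin 3) (f : (Fin 3 → ℂ) → ℂ) (z : Fin 3 → ℂ) : ℂ :=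
  (1 / 2 : ℂ) *
    (fderiv ℝ f z (Pi.single i 1) + s * fderiv ℝ f z (Pi.single i Complex.I))

lemma wd_eq (i) : wd i = wirt (-Complex.I) i := by
  funext f z; simp only [wd, wirt]; ring

lemma wdb_eq (i) : wdb i = wirt Complex.I i := rfl

variable {U : Set (Fin 3 → ℂ)}

lemma wirt_congr (hU : IsOpen U) (s i) {f h : (Fin 3 → ℂ) → ℂ} (hfh : ∀ z ∈ U, f z = h z) :
    ∀ z ∈ U, wirt s i f z = wirt s i h z := by
  intro z hz
  have : f =ᶠ[nhds z] h := Filter.eventually_of_mem (hU.mem_nhds hz) hfh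
  simp only [wirt, this.fderiv_eq]

lemma fderiv_smooth (hU : IsOpen U) (v) {f : (Fin 3 → ℂ) → ℂ}
    (hf : ContDiffOn ℝ (⊤ : ℕ∞) f U) : ContDiffOn ℝ (⊤ : ℕ∞) (fun z => fderiv ℝ f z v) U := by
  have h := hf.fderiv_of_isOpen (m := (⊤ : ℕ∞)) hU (by simp)
  exact h.clm_apply contDiffOn_const

lemma wirt_smooth (hU : IsOpen U) (s i) {f : (Fin 3 → ℂ) → ℂ}
    (hf : ContDiffOn ℝ (⊤ : ℕ∞) f U) : ContDiffOn ℝ (⊤ : ℕ∞) (wirt s i f) U :=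
  contDiffOn_const.mul ((fderiv_smooth hU _ hf).add
    (contDiffOn_const.mul (fderiv_smooth hU _ hf)))

lemma diffAt (hU : IsOpen U) {f : (Fin 3 → ℂ) → ℂ}
    (hf : ContDiffOn ℝ (⊤ : ℕ∞) f U) {z} (hz : z ∈ U) : DifferentiableAt ℝ f z :=
  (hf.contDiffAt (hU.mem_nhds hz)).differentiableAt (by simp)

lemma wirt_add (s i) {f h : (Fin 3 → ℂ) → ℂ} {z} (hf : DifferentiableAt ℝ f z)
    (hh : DifferentiableAt ℝ h z) :
    wirt s i (fun w => f w + h w) z = wirt s i f z + wirt s i h z := by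
  simp only [wirt, fderiv_fun_add hf hh, _root_.add_apply]; ring

lemma wirt_mul (s i) {f h : (Fin 3 → ℂ) → ℂ} {z} (hf : DifferentiableAt ℝ f z)
    (hh : DifferentiableAt ℝ h z) :
    wirt s i (fun w => f w * h w) z = f z * wirt s i h z + h z * wirt s i f z := by
  simp only [wirt, fderiv_fun_mul hf hh, _root_.add_apply,
    _root_.smul_apply, smul_eq_mul]; ring

lemma wirt_star (s i) {f : (Fin 3 → ℂ) → ℂ} {z} (hf : DifferentiableAt ℝ f z) :
    wirt (star s) i (fun w => star (f w)) z = star (wirt s i f z) := by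
  have h : HasFDerivAt (fun w => star (f w))
      ((Complex.conjCLE : ℂ →L[ℝ] ℂ).comp (fderiv ℝ f z)) z :=
    (Complex.conjCLE : ℂ →L[ℝ] ℂ).hasFDerivAt.comp z hf.hasFDerivAt
  simp only [wirt, h.fderiv]
  simp

lemma fderiv_fderiv_apply (hU : IsOpen U) {f : (Fin 3 → ℂ) → ℂ}
    (hf : ContDiffOn ℝ (⊤ : ℕ∞) f U) {z} (hz : z ∈ U) (v w) :
    fderiv ℝ (fun x => fderiv ℝ f x v) z w = fderiv ℝ (fderiv ℝ f) z w v := by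
  have h := hf.fderiv_of_isOpen (m := (⊤ : ℕ∞)) hU (by simp)
  have h' : DifferentiableAt ℝ (fderiv ℝ f) z :=
    (h.contDiffAt (hU.mem_nhds hz)).differentiableAt (by simp)
  rw [fderiv_clm_apply h' (differentiableAt_const _)]
  simp

lemma wirt_wirt (hU : IsOpen U) (s i t j) {f : (Fin 3 → ℂ) → ℂ}
    (hf : ContDiffOn ℝ (⊤ : ℕ∞) f U) {z} (hz : z ∈ U) :
    wirt s i (wirt t j f) z = (1 / 4 : ℂ) *
      (fderiv ℝ (fderiv ℝ f) z (Pi.single i 1) (Pi.single j 1)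
      + t * fderiv ℝ (fderiv ℝ f) z (Pi.single i 1) (Pi.single j Complex.I)
      + s * fderiv ℝ (fderiv ℝ f) z (Pi.single i Complex.I) (Pi.single j 1)
      + s * t * fderiv ℝ (fderiv ℝ f) z (Pi.single i Complex.I) (Pi.single j Complex.I)) := by
  have hd : ∀ v, DifferentiableAt ℝ (fun x => fderiv ℝ f x v) z := fun v =>
    diffAt hU (fderiv_smooth hU v hf) hz
  have key : ∀ w, fderiv ℝ (wirt t j f) z w = (1 / 2 : ℂ) *
      (fderiv ℝ (fderiv ℝ f) z w (Pi.single j 1)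
        + t * fderiv ℝ (fderiv ℝ f) z w (Pi.single j Complex.I)) := by
    intro w
    have : wirt t j f = fun x => (1 / 2 : ℂ) *
      (fderiv ℝ f x (Pi.single j 1) + t * fderiv ℝ f x (Pi.single j Complex.I)) := rfl
    rw [this, fderiv_const_mul ((hd _).fun_add ((hd _).const_mul _)),
      fderiv_fun_add (hd _) ((hd _).const_mul _), fderiv_const_mul (hd _)]
    simp only [_root_.smul_apply, _root_.add_apply, smul_eq_mul,
      fderiv_fderiv_apply hU hf hz]
  rw [wirt, key, key]; ring

lemma wirt_comm (hU : IsOpen U) (s i t j) {f : (Fin 3 → ℂ) → ℂ}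
    (hf : ContDiffOn ℝ (⊤ : ℕ∞) f U) {z} (hz : z ∈ U) :
    wirt s i (wirt t j f) z = wirt t j (wirt s i f) z := by
  have hs : IsSymmSndFDerivAt ℝ f z :=
    (hf.contDiffAt (hU.mem_nhds hz)).isSymmSndFDerivAt (by
      simp only [minSmoothness_of_isRCLikeNormedField]
      exact WithTop.coe_le_coe.mpr (le_top : (2 : ℕ∞) ≤ ⊤))
  rw [wirt_wirt hU _ _ _ _ hf hz, wirt_wirt hU _ _ _ _ hf hz,
    hs.eq (Pi.single i 1) (Pi.single j 1), hs.eq (Pi.single i 1) (Pi.single j Complex.I),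
    hs.eq (Pi.single i Complex.I) (Pi.single j 1),
    hs.eq (Pi.single i Complex.I) (Pi.single j Complex.I)]
  ring

lemma wirt_log (s i) {f : (Fin 3 → ℂ) → ℂ} {z} (hf : DifferentiableAt ℝ f z)
    (h0 : f z ∈ Complex.slitPlane) :
    f z * wirt s i (fun w => Complex.log (f w)) z = wirt s i f z := by
  have h1 : HasFDerivAt Complex.log _ (f z) :=
    (Complex.hasDerivAt_log h0).hasFDerivAt.restrictScalars ℝ
  have h := h1.comp z hf.hasFDerivAt
  have h' : fderiv ℝ (fun w => Complex.log (f w)) z = _ := h.fderiv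
  have hne := Complex.slitPlane_ne_zero h0
  simp only [wirt, h']
  simp
  field_simp

open Classical in
/-- Extension by zero. -/
noncomputable def ext0 (U : Set (Fin 3 → ℂ)) (f : U → ℂ) (z : Fin 3 → ℂ) : ℂ :=
  if h : z ∈ U then f ⟨z, h⟩ else 0

lemma ext0_apply (f : U → ℂ) {z} (hz : z ∈ U) : ext0 U f z = f ⟨z, hz⟩ := by
  simp [ext0, hz]

/-- Smooth functions on `U`. -/
def Sm (U : Set (Fin 3 → ℂ)) : StarSubalgebra ℂ (U → ℂ) where
  carrier := {f | ContDiffOn ℝ (⊤ : ℕ∞) (ext0 U f) U}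
  mul_mem' {a b} ha hb := (ContDiffOn.mul ha hb).congr fun z hz => by simp [ext0_apply _ hz]
  add_mem' {a b} ha hb := (ContDiffOn.add ha hb).congr fun z hz => by simp [ext0_apply _ hz]
  algebraMap_mem' r := (contDiffOn_const (c := r)).congr fun z hz => by simp [ext0_apply _ hz]
  star_mem' {a} ha := by
    have := (Complex.conjCLE : ℂ →L[ℝ] ℂ).contDiff.comp_contDiffOn ha
    exact this.congr fun z hz => by simp [ext0_apply _ hz]

lemma mem_Sm {f : U → ℂ} {F : (Fin 3 → ℂ) → ℂ} (hF : ContDiffOn ℝ (⊤ : ℕ∞) F U)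
    (h : ∀ u : U, f u = F u) : f ∈ Sm U :=
  hF.congr fun z hz => by rw [ext0_apply _ hz, h]

/-- Restriction of a smooth function. -/
def mkSm (F : (Fin 3 → ℂ) → ℂ) (hF : ContDiffOn ℝ (⊤ : ℕ∞) F U) : Sm U :=
  ⟨fun u => F u, mem_Sm hF fun _ => rfl⟩

/-- Wirtinger derivative as a derivation of the ring of smooth functions. -/
noncomputable def DSm (hU : IsOpen U) (s : ℂ) (i : Fin 3) : Derivation ℤ (Sm U) (Sm U) :=
  Derivation.mk' (AddMonoidHom.toIntLinearMap
    (AddMonoidHom.mk' (fun f : Sm U =>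
      mkSm (wirt s i (ext0 U f.1)) (wirt_smooth hU s i f.2)) (by
        intro a b
        ext ⟨z, hz⟩
        have h := wirt_add s i (diffAt hU a.2 hz) (diffAt hU b.2 hz)
        refine Eq.trans ?_ h
        exact wirt_congr hU s i (fun w hw => by simp [ext0_apply _ hw]) z hz))) (by
    intro a b
    ext ⟨z, hz⟩
    have h := wirt_mul s i (diffAt hU a.2 hz) (diffAt hU b.2 hz)
    rw [ext0_apply _ hz, ext0_apply _ hz] at h
    refine Eq.trans ?_ h
    exact wirt_congr hU s i (fun w hw => by simp [ext0_apply _ hw]) z hz)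

lemma DSm_apply (hU : IsOpen U) (s i) (f : Sm U) (F : (Fin 3 → ℂ) → ℂ)
    (h : ∀ u : U, f.1 u = F u) (u : U) : (DSm hU s i f).1 u = wirt s i F u :=
  wirt_congr hU s i (fun w hw => by rw [ext0_apply _ hw, h]) u.1 u.2

lemma DSm_comm (hU : IsOpen U) (s i t j) (f : Sm U) :
    DSm hU s i (DSm hU t j f) = DSm hU t j (DSm hU s i f) := by
  ext u
  rw [DSm_apply hU s i _ _ (DSm_apply hU t j f (ext0 U f.1) fun u => (ext0_apply _ u.2).symm),
    DSm_apply hU t j _ _ (DSm_apply hU s i f (ext0 U f.1) fun u => (ext0_apply _ u.2).symm)]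
  exact wirt_comm hU s i t j f.2 u.2

lemma DSm_star (hU : IsOpen U) (s i) (f : Sm U) :
    star (DSm hU s i f) = DSm hU (star s) i (star f) := by
  ext u
  rw [DSm_apply hU (star s) i (star f) (fun w => star (ext0 U f.1 w))
    (fun u => by rw [ext0_apply _ u.2]; rfl), wirt_star s i (diffAt hU f.2 u.2)]
  rfl

lemma isUnit_Sm (f : Sm U) (hf : ∀ u, f.1 u ≠ 0) : IsUnit f := by
  have h : ContDiffOn ℝ (⊤ : ℕ∞) (fun z => (ext0 U f.1 z)⁻¹) U :=
    ContDiffOn.inv f.2 fun z hz => by rw [ext0_apply _ hz]; exact hf _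
  refine IsUnit.of_mul_eq_one (mkSm _ h) ?_
  ext u
  have : f.1 u * (ext0 U f.1 u)⁻¹ = 1 := by
    rw [ext0_apply _ u.2]; exact mul_inv_cancel₀ (hf u)
  exact this

/-- Evaluation at a point. -/
def evSm (u : U) : Sm U →+* ℂ where
  toFun f := f.1 u
  map_one' := rfl
  map_mul' _ _ := rfl
  map_zero' := rfl
  map_add' _ _ := rfl

end Analysis

section Final
variable {U : Set (Fin 3 → ℂ)}

lemma ev_DSm (hU : IsOpen U) (s i) (f : Sm U) (F : (Fin 3 → ℂ) → ℂ)
    (h : ∀ u : U, evSm u f = F u) (u : U) : evSm u (DSm hU s i f) = wirt s i F u :=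
  DSm_apply hU s i f F h u

lemma Sm_ext {f h : Sm U} (H : ∀ u, evSm u f = evSm u h) : f = h := by
  ext u; exact H u

/-- Smooth matrix functions. -/
def matSm {n : ℕ} (M : (Fin 3 → ℂ) → Matrix (Fin n) (Fin n) ℂ)
    (hM : ∀ i j, ContDiffOn ℝ (⊤ : ℕ∞) (fun z => M z i j) U) : Matrix (Fin n) (Fin n) (Sm U) :=
  Matrix.of fun i j => mkSm (fun z => M z i j) (hM i j)

lemma ev_matSm {n : ℕ} (M : (Fin 3 → ℂ) → Matrix (Fin n) (Fin n) ℂ)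
    (hM : ∀ i j, ContDiffOn ℝ (⊤ : ℕ∞) (fun z => M z i j) U) (u : U) :
    (matSm M hM).map (evSm u) = M u := rfl

lemma ev_det {n : ℕ} (M : Matrix (Fin n) (Fin n) (Sm U)) (u : U) :
    evSm u M.det = (M.map (evSm u)).det := RingHom.map_det _ _

lemma unit_matSm {n : ℕ} (M : (Fin 3 → ℂ) → Matrix (Fin n) (Fin n) ℂ)
    (hM : ∀ i j, ContDiffOn ℝ (⊤ : ℕ∞) (fun z => M z i j) U) (hpd : ∀ z ∈ U, (M z).PosDef) :
    IsUnit (matSm M hM).det := by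
  refine isUnit_Sm _ fun u => ?_
  have : (matSm M hM).det.1 u = (M u).det := ev_det (matSm M hM) u
  rw [this]
  exact (hpd u u.2).det_pos.ne'

lemma ev_inv {n : ℕ} (M : Matrix (Fin n) (Fin n) (Sm U)) (h : IsUnit M.det) (u : U) :
    (M⁻¹).map (evSm u) = (M.map (evSm u))⁻¹ := by
  symm
  apply Matrix.inv_eq_right_inv
  rw [← Matrix.map_mul, Matrix.mul_nonsing_inv _ h]
  simp

lemma matSm_herm {n : ℕ} (M : (Fin 3 → ℂ) → Matrix (Fin n) (Fin n) ℂ)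
    (hM : ∀ i j, ContDiffOn ℝ (⊤ : ℕ∞) (fun z => M z i j) U) (hpd : ∀ z ∈ U, (M z).PosDef) :
    (matSm M hM)ᴴ = matSm M hM := by
  ext1 i j
  apply Sm_ext
  intro u
  exact (hpd u u.2).1.apply i j

lemma ev_trace {n : ℕ} (A B C D : Matrix (Fin n) (Fin n) (Sm U)) (u : U) :
    evSm u (trace (A * B * Cᴴ * D)) = trace (A.map (evSm u) * B.map (evSm u) *
      (C.map (evSm u))ᴴ * D.map (evSm u)) := by
  have hC : (C.map (evSm u))ᴴ = Cᴴ.map (evSm u) := by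
    ext i j; rfl
  rw [hC, ← Matrix.map_mul, ← Matrix.map_mul, ← Matrix.map_mul]
  simp only [Matrix.trace, Matrix.diag, map_sum]
  rfl

lemma ev_pair {n : ℕ} (S : HymSetup (Sm U) n) (a b) (u : U) :
    evSm u (S.pair a b) = ∑ i, ∑ j, (S.P.map (evSm u))ᵀ i j *
      trace ((a i).map (evSm u) * S.H.map (evSm u) * ((b j).map (evSm u))ᴴ *
        S.Q.map (evSm u)) := by
  simp only [HymSetup.pair, map_sum, map_mul, ev_trace]
  rfl

lemma ev_chern (hU : IsOpen U) {n : ℕ} (H : (Fin 3 → ℂ) → Matrix (Fin n) (Fin n) ℂ)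
    (hM : ∀ i j, ContDiffOn ℝ (⊤ : ℕ∞) (fun z => H z i j) U) (hpd : ∀ z ∈ U, (H z).PosDef)
    (i : Fin 3) (u : U) :
    (dM (DSm hU (-Complex.I) i) (matSm H hM) * (matSm H hM)⁻¹).map (evSm u) =
      chernForm H i u := by
  rw [Matrix.map_mul, ev_inv _ (unit_matSm H hM hpd), ev_matSm]
  ext a b
  simp only [chernForm, Matrix.mul_apply, Matrix.of_apply]
  refine Finset.sum_congr rfl fun c _ => ?_
  congr 1
  rw [wd_eq]
  exact ev_DSm hU _ _ _ (fun w => H w a c) (fun _ => rfl) u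

lemma ginv_eq (g ginv : Matrix (Fin 3) (Fin 3) ℂ)
    (h : ∀ i k, ∑ p, ginv i p * g k p = if i = k then 1 else 0) : g⁻¹ = ginvᵀ := by
  have h1 : ginv * gᵀ = 1 := by
    ext i k
    rw [Matrix.mul_apply, Matrix.one_apply]
    exact h i k
  apply Matrix.inv_eq_right_inv
  rw [← Matrix.transpose_inj, Matrix.transpose_mul, Matrix.transpose_transpose, h1,
    Matrix.transpose_one]

end Final
end Helpers

/-- Over a Ricci-flat Kähler domain `U ⊆ ℂ³`, the squared norm
`φ = ∑ g^{ij̄} tr(A_i·H·A_j*·H⁻¹)` of the Chern connection form `A_i = (∂H/∂z_i)H⁻¹` of a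
Hermitian–Yang–Mills metric `H` on a trivial bundle is subharmonic: at every point of `U`,
`∑ g^{ij̄} ∂²φ/∂z_i∂z̄_j` is a nonnegative real number, i.e. `−Δ_g |∂H·H⁻¹|²_{H,g} ≤ 0`. -/
theorem hym_connection_norm_subharmonic {n : ℕ} (U : Set (Fin 3 → ℂ)) (hU : IsOpen U)
    (g ginv : (Fin 3 → ℂ) → Matrix (Fin 3) (Fin 3) ℂ)
    (H : (Fin 3 → ℂ) → Matrix (Fin n) (Fin n) ℂ)
    (hg_smooth : ∀ i j, ContDiffOn ℝ (⊤ : ℕ∞) (fun z => g z i j) U)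
    (hg_pd : ∀ z ∈ U, (g z).PosDef)
    (hginv : ∀ z ∈ U, ∀ i k, ∑ p, ginv z i p * g z k p = if i = k then 1 else 0)
    (hKahler : ∀ z ∈ U, ∀ i j k,
      wd k (fun w => g w i j) z = wd i (fun w => g w k j) z)
    (hRicciFlat : ∀ z ∈ U, ∀ i j,
      wd i (wdb j (fun w => Complex.log ((g w).det))) z = 0)
    (hH_smooth : ∀ a b, ContDiffOn ℝ (⊤ : ℕ∞) (fun z => H z a b) U)
    (hH_pd : ∀ z ∈ U, (H z).PosDef)
    (hHYM : ∀ z ∈ U, ∀ a b : Fin n,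
      ∑ i, ∑ j, ginv z i j * wdb j (fun w => chernForm H i w a b) z = 0) :
    ∀ z ∈ U,
      0 ≤ ∑ i, ∑ j, ginv z i j *
        wd i (wdb j (fun w => ∑ i', ∑ j', ginv w i' j' *
          Matrix.trace (chernForm H i' w * H w * (chernForm H j' w).conjTranspose * (H w)⁻¹))) z := by
  have hg_u := unit_matSm g hg_smooth hg_pd
  have hH_u := unit_matSm H hH_smooth hH_pd
  have hPinv : ∀ u : U, ((matSm g hg_smooth)⁻¹).map (evSm u) = (ginv u).transpose := by
    intro u
    rw [ev_inv _ hg_u, ev_matSm, ginv_eq _ _ (hginv u u.2)]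
  have hPij : ∀ (u : U) i j, evSm u ((matSm g hg_smooth)⁻¹ j i) = ginv u i j := fun u i j =>
    congrFun (congrFun (hPinv u) j) i
  have hdet_sm : ContDiffOn ℝ (⊤ : ℕ∞) (fun z => (g z).det) U :=
    ContDiffOn.congr (matSm g hg_smooth).det.2 fun z hz => by
      rw [ext0_apply _ hz]; exact (ev_det (matSm g hg_smooth) ⟨z, hz⟩).symm
  have hdet_slit : ∀ z ∈ U, (g z).det ∈ Complex.slitPlane := fun z hz => by
    have h := (hg_pd z hz).det_pos
    rw [Complex.lt_def] at h
    exact Or.inl h.1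
  have hlog_sm : ContDiffOn ℝ (⊤ : ℕ∞) (fun z => Complex.log ((g z).det)) U := by
    intro z hz
    have h1 : ContDiffAt ℝ (⊤ : ℕ∞) Complex.log ((g z).det) :=
      (Complex.contDiffAt_log (hdet_slit z hz)).restrict_scalars ℝ
    exact h1.comp_contDiffWithinAt z (hdet_sm z hz)
  let S : HymSetup (Sm U) n :=
    { d := DSm hU (-Complex.I)
      e := DSm hU Complex.I
      dd := fun i j f => DSm_comm hU _ _ _ _ f
      de := fun i j f => DSm_comm hU _ _ _ _ f
      star_d := fun i f => by rw [DSm_star]; simp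
      g := matSm g hg_smooth
      P := (matSm g hg_smooth)⁻¹
      g_star := matSm_herm g hg_smooth hg_pd
      gP := Matrix.mul_nonsing_inv _ hg_u
      Pg := Matrix.nonsing_inv_mul _ hg_u
      kah := fun i j k => Sm_ext fun u => by
        rw [ev_DSm hU _ _ _ (fun w => g w i j) (fun _ => rfl),
          ev_DSm hU _ _ _ (fun w => g w k j) (fun _ => rfl), ← wd_eq, ← wd_eq]
        exact hKahler u u.2 i j k
      L := fun j => DSm hU Complex.I j (mkSm _ hlog_sm)
      hL := fun j => Sm_ext fun u => by
        rw [map_mul, ev_DSm hU _ _ _ (fun w => Complex.log ((g w).det)) (fun _ => rfl),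
          ev_DSm hU _ _ _ (fun w => (g w).det) (fun v => ev_det _ v), ev_det, ev_matSm]
        exact wirt_log _ _ (diffAt hU hdet_sm u.2) (hdet_slit u u.2)
      dL := fun i j => Sm_ext fun u => by
        rw [ev_DSm hU _ _ _ _ (ev_DSm hU _ _ _ (fun w => Complex.log ((g w).det))
          (fun _ => rfl)), map_zero, ← wd_eq, ← wdb_eq]
        exact hRicciFlat u u.2 i j
      H := matSm H hH_smooth
      Q := (matSm H hH_smooth)⁻¹
      H_star := matSm_herm H hH_smooth hH_pd
      HQ := Matrix.mul_nonsing_inv _ hH_u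
      QH := Matrix.nonsing_inv_mul _ hH_u
      hym := by
        ext1 a b
        apply Sm_ext
        intro u
        simp only [Matrix.sum_apply, Matrix.smul_apply, smul_eq_mul, map_sum, map_mul,
          Matrix.zero_apply, map_zero, hPij, dM_apply _ (_ * _)]
        rw [← hHYM u u.2 a b]
        refine Finset.sum_congr rfl fun i _ => Finset.sum_congr rfl fun j _ => ?_
        congr 1
        exact ev_DSm hU _ _ _ (fun w => chernForm H i w a b) (fun v =>
          congrFun (congrFun (ev_chern hU H hH_smooth hH_pd i v) a) b) u }
  intro z hz
  have hA : ∀ (i : Fin 3) (u : U), (S.A i).map (evSm u) = chernForm H i u :=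
    fun i u => ev_chern hU H hH_smooth hH_pd i u
  have hQ : ∀ u : U, S.Q.map (evSm u) = (H u)⁻¹ := fun u => by
    have := ev_inv _ hH_u u
    rwa [ev_matSm] at this
  have hHu : ∀ u : U, S.H.map (evSm u) = H u := fun u => rfl
  have hP : ∀ u : U, S.P.map (evSm u) = (ginv u).transpose := hPinv
  have hφ : ∀ u : U, evSm u (S.pair S.A S.A) = ∑ i', ∑ j', ginv u i' j' *
          Matrix.trace (chernForm H i' u * H u * (chernForm H j' u).conjTranspose * (H u)⁻¹) := by
    intro u
    rw [ev_pair]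
    simp only [hA, hQ, hHu, hP, Matrix.transpose_transpose]
  have hm := congrArg (evSm ⟨z, hz⟩) S.main
  simp only [map_add, map_sum, map_mul] at hm
  have hL : ∀ k l, evSm ⟨z, hz⟩ (S.d k (S.e l (S.pair S.A S.A))) =
      wd k (wdb l (fun w => ∑ i', ∑ j', ginv w i' j' *
          Matrix.trace (chernForm H i' w * H w * (chernForm H j' w).conjTranspose *
            (H w)⁻¹))) z := by
    intro k l
    rw [wd_eq, wdb_eq]
    exact ev_DSm hU _ _ _ _ (ev_DSm hU _ _ _ (fun w => ∑ i', ∑ j', ginv w i' j' *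
          Matrix.trace (chernForm H i' w * H w * (chernForm H j' w).conjTranspose *
            (H w)⁻¹)) hφ) ⟨z, hz⟩
  have hPz : ∀ i j, evSm ⟨z, hz⟩ (S.P j i) = ginv z i j := fun i j => hPij ⟨z, hz⟩ i j
  have hpsd' : (ginv z).transpose.PosSemidef := by
    rw [← ginv_eq _ _ (hginv z hz)]
    exact (hg_pd z hz).inv.posSemidef
  have hpsd : (ginv z).PosSemidef := by simpa using hpsd'.transpose
  simp only [hL, hPz, ev_pair, hQ, hHu, hP, Matrix.transpose_transpose] at hm
  rw [hm]
  refine add_nonneg ?_ ?_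
  · exact pair2_nonneg (H z) (hH_pd z hz) (ginv z) (ginv z) hpsd hpsd
      (fun k i => (S.nab k S.A i).map (evSm ⟨z, hz⟩))
  · rw [Finset.sum_comm]
    exact pair2_nonneg (H z) (hH_pd z hz) (ginv z) (ginv z).transpose hpsd hpsd'
      (fun k i => (S.nabb k S.A i).map (evSm ⟨z, hz⟩))
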